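/- Let L, p be positive integers, let l, l' be integers with 1 ≤ l < l' ≤ 2L + p − 1, and set T' = 2L + 2 + p − l' and T = 2L + 2 + p − l. Let s, r be integers with 0 ≤ s < r. Let m' be an integer with 0 ≤ m' < 2^{T'} satisfying |m' − Bits(s/r, l', 2L+1+p)| < 2^p and ⌊m' / 2^{T'−2}⌋ = Bits(s/r, l', l'+1). Let m be an integer with 0 ≤ m < 2^{l'+2−l} satisfying d_{l'+2−l}(m, Bits(s/r, l, l'+1)) ≤ 1. Then there exists b ∈ {−1, 0, 1} such that ((m mod 4) + b) mod 4 = ⌊m' / 2^{T'−2}⌋, and for any such b, the integer M = ((m + b) mod 2^{l'+2−l}) · 2^{T'−2} + (m' mod 2^{T'−2}) satisfies |M − Bits(s/r, l, 2L+1+p)| < 2^p and ⌊M / 2^{T−2}⌋ = Bits(s/r, l, l+1). -/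

import Mathlib

/-- `dDist t x y = min(|x - y|, 2^t - |x - y|)`. -/
def dDist (t : ℕ) (x y : ℤ) : ℤ := min |x - y| (2 ^ t - |x - y|)

/-- `bits ω i j` is the integer whose binary digits are the `i`-th through `j`-th
bits after the binary point of the binary expansion of `ω ∈ [0,1)`. -/
noncomputable def bits (ω : ℝ) (i j : ℕ) : ℤ := ⌊(2 : ℝ) ^ j * ω⌋ % 2 ^ (j - i + 1)

theorem floor_aux (ω : ℝ) (a k : ℕ) : ⌊(2 : ℝ) ^ (a + k) * ω⌋ / 2 ^ k = ⌊(2 : ℝ) ^ a * ω⌋ := by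
  have h := Int.floor_div_natCast ((2 : ℝ) ^ (a + k) * ω) (2 ^ k)
  have e : (2 : ℝ) ^ (a + k) * ω / ((2 ^ k : ℕ) : ℝ) = (2 : ℝ) ^ a * ω := by
    push_cast
    rw [pow_add]
    field_simp
  rw [e] at h
  rw [h]
  push_cast
  rfl

theorem emod_split (N P Q : ℤ) (hP : 0 < P) (hQ : 0 < Q) :
    N % (P * Q) = (N / P % Q) * P + N % P := by
  rw [Int.emod_def N (P * Q), Int.emod_def (N / P) Q, Int.emod_def N P,
    Int.ediv_ediv_of_nonneg hP.le]
  ring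

theorem core_e (R A m : ℤ) (hR : 4 ∣ R) (hR0 : 0 < R) (hm0 : 0 ≤ m) (hm : m < R)
    (hd : min |m - A % R| (R - |m - A % R|) ≤ 1) :
    ∃ e k : ℤ, -1 ≤ e ∧ e ≤ 1 ∧ m = A + e + R * k := by
  have h0 := Int.emod_nonneg A hR0.ne'
  have h1 := Int.emod_lt_of_pos A hR0
  have h2 := Int.emod_add_mul_ediv A R
  rcases min_le_iff.1 hd with h | h
  · rw [abs_le] at h
    exact ⟨m - A % R, -(A / R), h.1, h.2, by linarith⟩
  · rcases abs_cases (m - A % R) with ⟨h3, h4⟩ | ⟨h3, h4⟩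
    · exact ⟨m - A % R - R, 1 - (A / R), by linarith, by linarith, by linarith⟩
    · exact ⟨m - A % R + R, -1 - (A / R), by linarith, by linarith, by linarith⟩

theorem core_main (P S N m m' E : ℤ) (hP : 0 < P) (hS : 0 < S)
    (herr : |m' - N % (P * 4)| < E) (htop : m' / P = N / P % 4)
    (hm0 : 0 ≤ m) (hm : m < S * 4)
    (hd : min |m - N / P % (S * 4)| (S * 4 - |m - N / P % (S * 4)|) ≤ 1) :
    (∃ b ∈ ({-1, 0, 1} : Set ℤ), (m % 4 + b) % 4 = m' / P) ∧
    ∀ b ∈ ({-1, 0, 1} : Set ℤ), (m % 4 + b) % 4 = m' / P →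
      |((m + b) % (S * 4)) * P + m' % P - N % (P * (S * 4))| < E ∧
      (((m + b) % (S * 4)) * P + m' % P) / (P * S) = N / P / S % 4 := by
  obtain ⟨e, k, he1, he2, hk⟩ := core_e (S * 4) (N / P) m ⟨S, by ring⟩ (by linarith) hm0 hm hd
  rw [htop]
  rw [emod_split N P 4 hP (by norm_num)] at herr
  rw [emod_split N P (S * 4) hP (by linarith)]
  have hmm := Int.emod_add_mul_ediv m' P
  rw [htop] at hmm
  have hr0 := Int.emod_nonneg m' hP.ne'
  have hr1 := Int.emod_lt_of_pos m' hP
  generalize N / P = A at *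
  have hk' : m = A + e + 4 * (S * k) := by rw [hk]; ring
  generalize S * k = k' at hk'
  constructor
  · refine ⟨-e, ?_, ?_⟩
    · simp only [Set.mem_insert_iff, Set.mem_singleton_iff]; omega
    · omega
  · intro b hb hbe
    simp only [Set.mem_insert_iff, Set.mem_singleton_iff] at hb
    have hb' : b = -e := by omega
    have hB : (m + b) % (S * 4) = A % (S * 4) := by
      rw [hk, hb']
      have : A + e + S * 4 * k + -e = A + S * 4 * k := by ring
      rw [this, Int.add_mul_emod_self_left]
    rw [hB]
    constructor
    · convert herr using 2
      linarith
    · rw [← Int.ediv_ediv_of_nonneg hP.le, add_comm, Int.add_mul_ediv_right _ _ hP.ne',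
        Int.ediv_eq_zero_of_lt hr0 hr1, zero_add, emod_split A S 4 hS (by norm_num), add_comm,
        Int.add_mul_ediv_right _ _ hS.ne', Int.ediv_eq_zero_of_lt (Int.emod_nonneg A hS.ne')
        (Int.emod_lt_of_pos A hS), zero_add]

theorem stmt_12 (L p : ℕ) (hL : 0 < L) (hp : 0 < p)
    (l l' : ℕ) (hl : 1 ≤ l) (hll' : l < l') (hl' : l' ≤ 2 * L + p - 1)
    (s r : ℤ) (hs : 0 ≤ s) (hsr : s < r)
    (m' : ℤ) (hm'0 : 0 ≤ m') (hm'lt : m' < 2 ^ (2 * L + 2 + p - l'))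
    (hm'err : |m' - bits ((s : ℝ) / (r : ℝ)) l' (2 * L + 1 + p)| < 2 ^ p)
    (hm'top : m' / 2 ^ (2 * L + 2 + p - l' - 2) = bits ((s : ℝ) / (r : ℝ)) l' (l' + 1))
    (m : ℤ) (hm0 : 0 ≤ m) (hmlt : m < 2 ^ (l' + 2 - l))
    (hd : dDist (l' + 2 - l) m (bits ((s : ℝ) / (r : ℝ)) l (l' + 1)) ≤ 1) :
    (∃ b ∈ ({-1, 0, 1} : Set ℤ),
        (m % 4 + b) % 4 = m' / 2 ^ (2 * L + 2 + p - l' - 2)) ∧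
    ∀ b ∈ ({-1, 0, 1} : Set ℤ),
      (m % 4 + b) % 4 = m' / 2 ^ (2 * L + 2 + p - l' - 2) →
      |((m + b) % 2 ^ (l' + 2 - l)) * 2 ^ (2 * L + 2 + p - l' - 2) +
          m' % 2 ^ (2 * L + 2 + p - l' - 2) -
          bits ((s : ℝ) / (r : ℝ)) l (2 * L + 1 + p)| < 2 ^ p ∧
      (((m + b) % 2 ^ (l' + 2 - l)) * 2 ^ (2 * L + 2 + p - l' - 2) +
          m' % 2 ^ (2 * L + 2 + p - l' - 2)) / 2 ^ (2 * L + 2 + p - l - 2) =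
        bits ((s : ℝ) / (r : ℝ)) l (l + 1) := by
  obtain ⟨c, rfl⟩ := Nat.exists_eq_add_of_lt hll'
  obtain ⟨K, hK⟩ : ∃ K, 2 * L + 1 + p = l + c + 1 + 1 + K :=
    ⟨2 * L + 1 + p - (l + c + 1 + 1), by omega⟩
  have e1 : 2 * L + 2 + p - (l + c + 1) - 2 = K := by omega
  have e2 : l + c + 1 + 2 - l = (c + 1) + 2 := by omega
  have e3 : 2 * L + 2 + p - l - 2 = K + (c + 1) := by omega
  have f1 := floor_aux ((s : ℝ) / r) (l + c + 1 + 1) K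
  have f2 := floor_aux ((s : ℝ) / r) (l + 1) (c + 1)
  have e4 : l + 1 + (c + 1) = l + c + 1 + 1 := by omega
  rw [e4] at f2
  have g1 : l + c + 1 + 1 + K - (l + c + 1) + 1 = K + 2 := by omega
  have g2 : l + c + 1 + 1 - (l + c + 1) + 1 = 2 := by omega
  have g3 : l + c + 1 + 1 - l + 1 = (c + 1) + 2 := by omega
  have g4 : l + c + 1 + 1 + K - l + 1 = K + ((c + 1) + 2) := by omega
  have g5 : l + 1 - l + 1 = 2 := by omega
  have four : (2 : ℤ) ^ 2 = 4 := by norm_num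
  clear hm'lt
  simp only [bits, dDist, hK, e1, e2, e3, g1, g2, g3, g4, g5] at *
  rw [← f2]
  rw [← f1] at *
  have q1 : (2 : ℤ) ^ (K + 2) = 2 ^ K * 4 := by ring
  have q2 : (2 : ℤ) ^ (c + 1 + 2) = 2 ^ (c + 1) * 4 := by ring
  have q3 : (2 : ℤ) ^ (K + (c + 1 + 2)) = 2 ^ K * (2 ^ (c + 1) * 4) := by ring
  have q4 : (2 : ℤ) ^ (K + (c + 1)) = 2 ^ K * 2 ^ (c + 1) := by ring
  rw [q1] at hm'err
  rw [four] at hm'top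
  rw [q2] at hmlt hd
  rw [q2, q3, q4, four]
  exact core_main (2 ^ K) (2 ^ (c + 1)) _ m m' (2 ^ p) (by positivity) (by positivity)
    hm'err hm'top hm0 hmlt hd
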